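/- In the setting of the per-product confidence-gap bound (T_i(ℓ) = #{τ ≤ ℓ : i ∈ S_τ}, v_{i,ℓ}^LCB ≤ v_i ≤ v_{i,ℓ}^UCB with gaps at most C₁√(v_i log(√N T⁴+1)/T_i(ℓ)) + C₂ log(√N T⁴+1)/T_i(ℓ) whenever i ∈ S_ℓ), assume in addition that |S_ℓ| ≤ K for all ℓ, that L ≤ T, and that v_i ≤ v_max ≤ 1 for all i. Then there is a constant C depending only on C₁ and C₂ such that for every ℓ* ∈ {1,…,L}, Σ_{ℓ=ℓ*}^L Σ_{i,j ∈ {1,…,N}} 1_{i∈S_ℓ} 1_{j∈S_ℓ} (v_{j,ℓ}^UCB − v_j) ≤ C · log(√N·T⁴ + 1)² · ( N² + K·√(K·N·T·v_max) ). -/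

import Mathlib

/-- Summing a function of the running count of a predicate over the times at which the predicate
holds amounts to summing the function over an initial segment. -/
theorem sum_filter_running_count (p : ℕ → Prop) [DecidablePred p] (f : ℕ → ℝ) (L : ℕ) :
    ∑ ℓ ∈ Finset.Icc 1 L, (if p ℓ then f ((Finset.Icc 1 ℓ).filter p).card else 0)
      = ∑ k ∈ Finset.Icc 1 ((Finset.Icc 1 L).filter p).card, f k := by
  induction L with
  | zero => simp
  | succ L ih =>
    have hI : Finset.Icc 1 (L + 1) = insert (L + 1) (Finset.Icc 1 L) := by
      ext x; simp only [Finset.mem_Icc, Finset.mem_insert]; omega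
    rw [Finset.sum_Icc_succ_top (by omega), ih]
    by_cases h : p (L + 1)
    · have hc : ((Finset.Icc 1 (L + 1)).filter p).card
          = ((Finset.Icc 1 L).filter p).card + 1 := by
        rw [hI, Finset.filter_insert, if_pos h, Finset.card_insert_of_notMem (by simp)]
      rw [if_pos h, hc, Finset.sum_Icc_succ_top (by omega)]
    · have hc : ((Finset.Icc 1 (L + 1)).filter p).card = ((Finset.Icc 1 L).filter p).card := by
        rw [hI, Finset.filter_insert, if_neg h]
      rw [if_neg h, hc, add_zero]

theorem sum_Icc_inv_sqrt_le (n : ℕ) :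
    ∑ k ∈ Finset.Icc 1 n, (Real.sqrt k)⁻¹ ≤ 2 * Real.sqrt n := by
  induction n with
  | zero => simp
  | succ n ih =>
    rw [Finset.sum_Icc_succ_top (by omega)]
    have hpos : 0 < Real.sqrt ((n + 1 : ℕ) : ℝ) := Real.sqrt_pos.2 (by positivity)
    have h1 : Real.sqrt ((n + 1 : ℕ) : ℝ) ^ 2 = n + 1 := by
      rw [Real.sq_sqrt (by positivity)]; push_cast; ring
    have h2 : Real.sqrt (n : ℝ) ^ 2 = n := Real.sq_sqrt (by positivity)
    have h3 : (Real.sqrt ((n + 1 : ℕ) : ℝ))⁻¹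
        ≤ 2 * Real.sqrt ((n + 1 : ℕ) : ℝ) - 2 * Real.sqrt n := by
      rw [inv_le_iff_one_le_mul₀ hpos]
      nlinarith [sq_nonneg (Real.sqrt ((n + 1 : ℕ) : ℝ) - Real.sqrt n)]
    linarith

theorem sum_Icc_inv_le_one_add_log {n T : ℕ} (hn : n ≤ T) :
    ∑ k ∈ Finset.Icc 1 n, (k : ℝ)⁻¹ ≤ 1 + Real.log T := by
  have h : ∑ k ∈ Finset.Icc 1 n, (k : ℝ)⁻¹ = ((harmonic n : ℚ) : ℝ) := by
    rw [harmonic_eq_sum_Icc]; push_cast; rfl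
  rw [h]
  refine (harmonic_le_one_add_log n).trans ?_
  rcases Nat.eq_zero_or_pos n with rfl | h0
  · simpa using Real.log_natCast_nonneg T
  · gcongr

/-- The numbers of times the individual items are offered have square roots summing to at most
`√(N K T)`. -/
theorem sum_sqrt_offer_count_le {N T L K : ℕ} (hLT : L ≤ T) (S : ℕ → Finset (Fin N))
    (hS : ∀ ℓ, (S ℓ).card ≤ K) :
    ∑ j : Fin N, Real.sqrt (((Finset.Icc 1 L).filter (fun τ => j ∈ S τ)).card : ℝ)
      ≤ Real.sqrt (N * (K * T)) := by
  have hcount : ∑ j : Fin N, ((Finset.Icc 1 L).filter (fun τ => j ∈ S τ)).card ≤ K * T := by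
    simp_rw [Finset.card_filter]
    rw [Finset.sum_comm]
    calc ∑ τ ∈ Finset.Icc 1 L, ∑ j : Fin N, (if j ∈ S τ then 1 else 0)
        ≤ ∑ τ ∈ Finset.Icc 1 L, K := by
          refine Finset.sum_le_sum fun τ _ => ?_
          simpa using hS τ
      _ = L * K := by simp
      _ ≤ K * T := by rw [mul_comm]; exact Nat.mul_le_mul_left K hLT
  have hcount' : ∑ j : Fin N, (((Finset.Icc 1 L).filter (fun τ => j ∈ S τ)).card : ℝ)
      ≤ K * T := by exact_mod_cast hcount
  apply Real.le_sqrt_of_sq_le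
  refine sq_sum_le_card_mul_sum_sq.trans ?_
  simp only [Finset.card_univ, Fintype.card_fin, Nat.cast_nonneg, Real.sq_sqrt]
  gcongr

theorem half_le_log_and_log_le {N T : ℕ} (hN : 0 < N) (hT : 0 < T) :
    1 / 2 ≤ Real.log (Real.sqrt N * (T : ℝ) ^ 4 + 1) ∧
      Real.log T ≤ Real.log (Real.sqrt N * (T : ℝ) ^ 4 + 1) := by
  have hN1 : (1 : ℝ) ≤ Real.sqrt N := Real.one_le_sqrt.2 (by exact_mod_cast hN)
  have hT1 : (1 : ℝ) ≤ T := by exact_mod_cast hT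
  have hT4 : (T : ℝ) ≤ (T : ℝ) ^ 4 := le_self_pow₀ hT1 (by norm_num)
  have hprod : (T : ℝ) ≤ Real.sqrt N * (T : ℝ) ^ 4 := by nlinarith
  constructor
  · have h : Real.log 2 ≤ Real.log (Real.sqrt N * (T : ℝ) ^ 4 + 1) :=
      Real.log_le_log (by norm_num) (by linarith)
    linarith [Real.log_two_gt_d9]
  · exact Real.log_le_log (by linarith) (by linarith)

/-- Double-sum confidence-gap bound (third point of the auxiliary lemma on the
estimates `v^LCB, v^UCB`). -/
theorem stmt_4 (C₁ C₂ : ℝ) (hC₁ : 0 ≤ C₁) (hC₂ : 0 ≤ C₂) :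
    ∃ C : ℝ, ∀ (N T L K : ℕ), 0 < N → 0 < T → 0 < L → 0 < K → L ≤ T →
    ∀ (S : ℕ → Finset (Fin N)) (v : Fin N → ℝ) (vLCB vUCB : Fin N → ℕ → ℝ) (vmax : ℝ),
    (∀ ℓ, (S ℓ).card ≤ K) →
    vmax ≤ 1 →
    (∀ i, 0 ≤ v i ∧ v i ≤ vmax) →
    (∀ i ℓ, vLCB i ℓ ≤ v i ∧ v i ≤ vUCB i ℓ) →
    (∀ (i : Fin N), ∀ ℓ ∈ Finset.Icc 1 L, i ∈ S ℓ →
      max (vUCB i ℓ - v i) (v i - vLCB i ℓ)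
        ≤ C₁ * Real.sqrt (v i * Real.log (Real.sqrt N * (T : ℝ) ^ 4 + 1)
              / (((Finset.Icc 1 ℓ).filter (fun τ => i ∈ S τ)).card : ℝ))
          + C₂ * (Real.log (Real.sqrt N * (T : ℝ) ^ 4 + 1)
              / (((Finset.Icc 1 ℓ).filter (fun τ => i ∈ S τ)).card : ℝ))) →
    ∀ ℓs ∈ Finset.Icc 1 L,
      (∑ ℓ ∈ Finset.Icc ℓs L, ∑ i : Fin N, ∑ j : Fin N,
          (if i ∈ S ℓ then (1 : ℝ) else 0) * (if j ∈ S ℓ then vUCB j ℓ - v j else 0))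
        ≤ C * Real.log (Real.sqrt N * (T : ℝ) ^ 4 + 1) ^ 2 *
            ((N : ℝ) ^ 2 + (K : ℝ) * Real.sqrt ((K : ℝ) * N * T * vmax)) := by
  refine ⟨8 * C₁ + 3 * C₂, ?_⟩
  intro N T L K hN hT _ _ hLT S v vLCB vUCB vmax hS _ hv _ hgap ℓs hℓs
  obtain ⟨hΛ, hlogT⟩ := half_le_log_and_log_le hN hT
  set Λ := Real.log (Real.sqrt N * (T : ℝ) ^ 4 + 1)
  have hvmax : 0 ≤ vmax := (hv ⟨0, hN⟩).1.trans (hv ⟨0, hN⟩).2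
  set a : ℝ := K * (C₁ * Real.sqrt (vmax * Λ)) with ha
  set b : ℝ := N * (C₂ * Λ) with hb
  have ha0 : 0 ≤ a := by positivity
  have hb0 : 0 ≤ b := by positivity
  set n : Fin N → ℕ → ℕ := fun j ℓ => ((Finset.Icc 1 ℓ).filter (fun τ => j ∈ S τ)).card
  set f : ℕ → ℝ := fun k => a * (Real.sqrt k)⁻¹ + b * (k : ℝ)⁻¹ with hf
  have hf0 : ∀ k, 0 ≤ f k := fun k => by positivity
  have hepoch : ∀ ℓ ∈ Finset.Icc 1 L,
      (∑ i : Fin N, ∑ j : Fin N,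
        (if i ∈ S ℓ then (1 : ℝ) else 0) * (if j ∈ S ℓ then vUCB j ℓ - v j else 0))
        ≤ ∑ j : Fin N, if j ∈ S ℓ then f (n j ℓ) else 0 := by
    intro ℓ hℓ
    have hcardN : ((S ℓ).card : ℝ) ≤ N := by exact_mod_cast card_finset_fin_le (S ℓ)
    have hcardK : ((S ℓ).card : ℝ) ≤ K := by exact_mod_cast hS ℓ
    rw [← Finset.sum_mul_sum, Finset.mul_sum]
    refine Finset.sum_le_sum fun j _ => ?_
    by_cases hj : j ∈ S ℓ
    · have hcard : ∑ i : Fin N, (if i ∈ S ℓ then (1 : ℝ) else 0) = (S ℓ).card := by simp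
      rw [if_pos hj, if_pos hj, hcard]
      have hbound := (le_max_left _ _).trans (hgap j ℓ hℓ hj)
      have hsqrt : Real.sqrt (v j * Λ / (n j ℓ : ℝ))
          ≤ Real.sqrt (vmax * Λ) * (Real.sqrt (n j ℓ))⁻¹ := by
        rw [Real.sqrt_div' _ (Nat.cast_nonneg _), div_eq_mul_inv]
        gcongr
        exact (hv j).2
      calc ((S ℓ).card : ℝ) * (vUCB j ℓ - v j)
          ≤ (S ℓ).card * (C₁ * (Real.sqrt (vmax * Λ) * (Real.sqrt (n j ℓ))⁻¹)
              + C₂ * (Λ * (n j ℓ : ℝ)⁻¹)) := by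
            refine mul_le_mul_of_nonneg_left (hbound.trans ?_) (Nat.cast_nonneg _)
            rw [← div_eq_mul_inv Λ]
            gcongr
        _ = (S ℓ).card * (C₁ * (Real.sqrt (vmax * Λ) * (Real.sqrt (n j ℓ))⁻¹))
              + (S ℓ).card * (C₂ * (Λ * (n j ℓ : ℝ)⁻¹)) := mul_add _ _ _
        _ ≤ K * (C₁ * (Real.sqrt (vmax * Λ) * (Real.sqrt (n j ℓ))⁻¹))
              + N * (C₂ * (Λ * (n j ℓ : ℝ)⁻¹)) := by gcongr
        _ = f (n j ℓ) := by simp only [hf, ha, hb]; ring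
    · simp [hj]
  have hitem : ∀ j : Fin N, (∑ ℓ ∈ Finset.Icc 1 L, if j ∈ S ℓ then f (n j ℓ) else 0)
      ≤ 2 * a * Real.sqrt (n j L) + b * (3 * Λ) := by
    intro j
    rw [sum_filter_running_count (fun τ => j ∈ S τ) f L]
    change ∑ k ∈ Finset.Icc 1 (n j L), f k ≤ _
    have hnT : n j L ≤ T :=
      ((Finset.card_filter_le _ _).trans (by simp)).trans hLT
    simp only [hf]
    rw [Finset.sum_add_distrib, ← Finset.mul_sum, ← Finset.mul_sum]
    have h1 := mul_le_mul_of_nonneg_left (sum_Icc_inv_sqrt_le (n j L)) ha0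
    have h2 := mul_le_mul_of_nonneg_left
      ((sum_Icc_inv_le_one_add_log hnT).trans (by linarith : _ ≤ 3 * Λ)) hb0
    linarith
  have hΛsqrt : Real.sqrt Λ ≤ 4 * Λ ^ 2 := by
    rw [Real.sqrt_le_left (by positivity)]
    nlinarith [pow_le_pow_left₀ (by norm_num) hΛ 3]
  calc _ ≤ ∑ ℓ ∈ Finset.Icc ℓs L, ∑ j : Fin N, (if j ∈ S ℓ then f (n j ℓ) else 0) :=
        Finset.sum_le_sum fun ℓ hℓ => hepoch ℓ
          (Finset.Icc_subset_Icc_left (Finset.mem_Icc.1 hℓs).1 hℓ)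
    _ ≤ ∑ ℓ ∈ Finset.Icc 1 L, ∑ j : Fin N, (if j ∈ S ℓ then f (n j ℓ) else 0) := by
        refine Finset.sum_le_sum_of_subset_of_nonneg
          (Finset.Icc_subset_Icc_left (Finset.mem_Icc.1 hℓs).1) fun ℓ _ _ => ?_
        exact Finset.sum_nonneg fun j _ => by split_ifs <;> simp [hf0]
    _ = ∑ j : Fin N, ∑ ℓ ∈ Finset.Icc 1 L, (if j ∈ S ℓ then f (n j ℓ) else 0) :=
        Finset.sum_comm
    _ ≤ ∑ j : Fin N, (2 * a * Real.sqrt (n j L) + b * (3 * Λ)) :=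
        Finset.sum_le_sum fun j _ => hitem j
    _ = 2 * a * ∑ j : Fin N, Real.sqrt (n j L) + N * (b * (3 * Λ)) := by
        rw [Finset.sum_add_distrib, ← Finset.mul_sum]; simp
    _ ≤ 2 * a * Real.sqrt (N * (K * T)) + N * (b * (3 * Λ)) := by
        gcongr
        exact sum_sqrt_offer_count_le hLT S hS
    _ = 2 * C₁ * (K * Real.sqrt (K * N * T * vmax)) * Real.sqrt Λ
          + 3 * C₂ * Λ ^ 2 * (N : ℝ) ^ 2 := by
        have h : (K : ℝ) * N * T * vmax = vmax * (N * (K * T)) := by ring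
        rw [h, Real.sqrt_mul hvmax, ha, hb, Real.sqrt_mul hvmax]
        ring
    _ ≤ 2 * C₁ * (K * Real.sqrt (K * N * T * vmax)) * (4 * Λ ^ 2)
          + 3 * C₂ * Λ ^ 2 * (N : ℝ) ^ 2 := by gcongr
    _ ≤ _ := by
        have h1 : 0 ≤ 8 * C₁ * Λ ^ 2 * (N : ℝ) ^ 2 := by positivity
        have h2 : 0 ≤ 3 * C₂ * Λ ^ 2 * (K * Real.sqrt (K * N * T * vmax)) := by positivity
        linarith
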